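/- arXiv:2304.14723 — 2 statements merged into one kernel-verified Lean document; each statement's English description precedes it below -/
import Mathlib

section
/- Let s > 3/2. There is a constant C such that for all f, g ∈ H^s(ℝ), the commutator [Λ^s, f] D_x g := Λ^s(f · g') − f · Λ^s(g') satisfies ‖[Λ^s, f] D_x g‖_{L²} ≤ C ‖f‖_{H^s} ‖g‖_{H^s}. -/
open MeasureTheory

/-- Fourier transform of a function on `ℝ`: `û(ξ) = ∫ e^{-iξx} u(x) dx`. -/
noncomputable def ft (u : ℝ → ℂ) (ξ : ℝ) : ℂ :=
  ∫ x : ℝ, Complex.exp (-(Complex.I * ξ * x)) * u x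

/-- Inverse Fourier transform. -/
noncomputable def invFt (U : ℝ → ℂ) : ℝ → ℂ :=
  fun x => (2 * Real.pi : ℝ)⁻¹ • ∫ ξ : ℝ, Complex.exp (Complex.I * ξ * x) * U ξ

/-- The Bessel potential operator `Λ^s = (1 − D_x²)^{s/2}`: the Fourier multiplier
with symbol `(1+ξ²)^{s/2}`. -/
noncomputable def lam (s : ℝ) (w : ℝ → ℂ) : ℝ → ℂ :=
  invFt fun ξ => (((1 + ξ ^ 2) ^ (s / 2) : ℝ) : ℂ) * ft w ξ

/-- The `H^s` norm expressed in terms of the Fourier data `U = û`. -/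
noncomputable def hsNorm (s : ℝ) (U : ℝ → ℂ) : ℝ :=
  (∫ ξ : ℝ, (1 + ξ ^ 2) ^ s * ‖U ξ‖ ^ 2) ^ ((1 : ℝ) / 2)

namespace CommAux

open Real FourierTransform SchwartzMap
open scoped ENNReal Convolution

/-- weight -/
noncomputable def wt (r x : ℝ) : ℝ := (1 + (2 * π * x) ^ 2) ^ r

lemma wt_pos (r x : ℝ) : 0 < wt r x := by unfold wt; positivity

lemma wt_cont (r : ℝ) : Continuous (wt r) := by
  unfold wt
  refine Continuous.rpow_const (by fun_prop) (fun x => Or.inl ?_)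
  positivity

lemma wt_mul (r r' x : ℝ) : wt r x * wt r' x = wt (r + r') x := by
  unfold wt; rw [Real.rpow_add (by positivity)]

lemma wt_temperate (r : ℝ) : (wt r).HasTemperateGrowth := by
  have h1 := Function.hasTemperateGrowth_one_add_norm_sq_rpow ℝ r
  have h2 : (fun x : ℝ => (2 * π) * x).HasTemperateGrowth := by fun_prop
  have := h1.comp h2
  have e : wt r = (fun x : ℝ => (1 + ‖x‖ ^ 2) ^ r) ∘ fun x => 2 * π * x := by
    funext x
    simp only [wt, Function.comp, Real.norm_eq_abs, sq_abs]
  rw [e]; exact this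

lemma wtC_temperate (r : ℝ) : (fun x => ((wt r x : ℝ) : ℂ)).HasTemperateGrowth :=
  Function.Complex.hasTemperateGrowth_ofReal.comp (wt_temperate r)

lemma wt_integrable {r : ℝ} (hr : r < -(1/2)) : Integrable (wt r) := by
  have h := integrable_rpow_neg_one_add_norm_sq (E := ℝ) (μ := volume) (r := -2 * r) (by simp; linarith)
  have h2 := h.comp_mul_left' (R := 2 * π) (by positivity)
  convert h2 using 1
  ext x
  simp only [wt, Real.norm_eq_abs, sq_abs]
  congr 1; ring

lemma pointwise (s : ℝ) (hs : 1 < s) (x y : ℝ) :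
    |(1 + x ^ 2) ^ (s / 2) - (1 + y ^ 2) ^ (s / 2)| ≤
      s * 4 ^ ((s - 1) / 2) * (|x - y| * ((1 + (x - y) ^ 2) ^ ((s - 1) / 2) + (1 + y ^ 2) ^ ((s - 1) / 2))) := by
  have hd : ∀ z : ℝ, HasDerivAt (fun z : ℝ => (1 + z ^ 2) ^ (s / 2))
      (2 * z * (s / 2) * (1 + z ^ 2) ^ (s / 2 - 1)) z := by
    intro z
    have h1 : HasDerivAt (fun z : ℝ => 1 + z ^ 2) (2 * z) z := by
      simpa using (hasDerivAt_pow 2 z).const_add 1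
    exact h1.rpow_const (Or.inl (by positivity))
  have key := (convex_uIcc y x).norm_image_sub_le_of_norm_hasDerivWithin_le
    (f := fun z : ℝ => (1 + z ^ 2) ^ (s / 2)) (x := y) (y := x)
    (C := s * 4 ^ ((s - 1) / 2) * ((1 + (x - y) ^ 2) ^ ((s - 1) / 2) + (1 + y ^ 2) ^ ((s - 1) / 2)))
    (fun z _ => (hd z).hasDerivWithinAt) ?_ Set.left_mem_uIcc Set.right_mem_uIcc
  · rw [Real.norm_eq_abs, Real.norm_eq_abs] at key
    refine key.trans (le_of_eq ?_)
    ring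
  · intro z hz
    have hzy : |z - y| ≤ |x - y| := Set.abs_sub_left_of_mem_uIcc hz
    have hp : (0:ℝ) < 1 + z ^ 2 := by positivity
    have habs : |z| ≤ (1 + z ^ 2) ^ ((1:ℝ) / 2) := by
      rw [← Real.sqrt_eq_rpow]
      exact Real.abs_le_sqrt (by linarith)
    have e1 : ‖2 * z * (s / 2) * (1 + z ^ 2) ^ (s / 2 - 1)‖ ≤ s * (1 + z ^ 2) ^ ((s - 1) / 2) := by
      have : (1 + z ^ 2) ^ ((s - 1) / 2) = (1 + z ^ 2) ^ ((1:ℝ) / 2) * (1 + z ^ 2) ^ (s / 2 - 1) := by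
        rw [← Real.rpow_add hp]; congr 1; ring
      rw [this, Real.norm_eq_abs, abs_mul, abs_of_pos (Real.rpow_pos_of_pos hp _)]
      have : |2 * z * (s / 2)| = s * |z| := by
        rw [show 2 * z * (s / 2) = s * z by ring, abs_mul, abs_of_pos (by linarith)]
      rw [this]
      have := Real.rpow_pos_of_pos hp (s / 2 - 1)
      rw [mul_assoc]
      gcongr
    refine e1.trans ?_
    rw [mul_assoc]
    refine mul_le_mul_of_nonneg_left ?_ (by linarith)
    have hz2 : z ^ 2 ≤ 2 * (x - y) ^ 2 + 2 * y ^ 2 := by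
      have h1 : (z - y) ^ 2 ≤ (x - y) ^ 2 := sq_le_sq.mpr hzy
      nlinarith [sq_nonneg (z - 2 * y)]
    have hq : 0 ≤ (s - 1) / 2 := by linarith
    rcases le_total ((x - y) ^ 2) (y ^ 2) with h | h
    · calc (1 + z ^ 2) ^ ((s - 1) / 2) ≤ (4 * (1 + y ^ 2)) ^ ((s - 1) / 2) := by
            apply Real.rpow_le_rpow hp.le _ hq; nlinarith
        _ = 4 ^ ((s - 1) / 2) * (1 + y ^ 2) ^ ((s - 1) / 2) := by
            rw [Real.mul_rpow (by norm_num) (by positivity)]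
        _ ≤ _ := by
            gcongr
            have : 0 ≤ (1 + (x - y) ^ 2) ^ ((s - 1) / 2) := by positivity
            linarith
    · calc (1 + z ^ 2) ^ ((s - 1) / 2) ≤ (4 * (1 + (x - y) ^ 2)) ^ ((s - 1) / 2) := by
            apply Real.rpow_le_rpow hp.le _ hq; nlinarith
        _ = 4 ^ ((s - 1) / 2) * (1 + (x - y) ^ 2) ^ ((s - 1) / 2) := by
            rw [Real.mul_rpow (by norm_num) (by positivity)]
        _ ≤ _ := by
            gcongr
            have : 0 ≤ (1 + y ^ 2) ^ ((s - 1) / 2) := by positivity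
            linarith

/-- Cauchy-Schwarz -/
lemma cs_lint {a b : ℝ → ℝ≥0∞} (ha : Measurable a) (hb : Measurable b) :
    (∫⁻ t, a t * b t) ^ 2 ≤ (∫⁻ t, a t ^ 2) * ∫⁻ t, b t ^ 2 := by
  have h := ENNReal.lintegral_mul_le_Lp_mul_Lq volume Real.HolderConjugate.two_two
    ha.aemeasurable hb.aemeasurable
  simp only [Pi.mul_apply, ENNReal.rpow_two] at h
  calc _ ≤ _ := pow_le_pow_left' h 2
    _ = _ := by
      rw [mul_pow, ← ENNReal.rpow_two, ← ENNReal.rpow_two, ← ENNReal.rpow_mul, ← ENNReal.rpow_mul]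
      norm_num

/-- Young -/
lemma young {a b : ℝ → ℝ≥0∞} (ha : Measurable a) (hb : Measurable b) :
    ∫⁻ x, (∫⁻ t, a t * b (x - t)) ^ 2 ≤ (∫⁻ t, a t) ^ 2 * ∫⁻ t, b t ^ 2 := by
  have h1 : ∀ x, (∫⁻ t, a t * b (x - t)) ^ 2 ≤ (∫⁻ t, a t) * ∫⁻ t, a t * b (x - t) ^ 2 := by
    intro x
    have hm : Measurable (fun t => a t ^ (1/2 : ℝ)) := ha.pow_const _
    have hm2 : Measurable (fun t => a t ^ (1/2 : ℝ) * b (x - t)) := by fun_prop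
    have := cs_lint hm hm2
    have e : ∀ t, (a t ^ (1/2 : ℝ)) * a t ^ (1/2 : ℝ) = a t := fun t => by
      rw [← ENNReal.rpow_add_of_nonneg _ _ (by norm_num) (by norm_num)]; norm_num
    simpa only [mul_pow, ← mul_assoc, e, sq (a _ ^ (1/2 : ℝ))] using this
  calc _ ≤ ∫⁻ x, (∫⁻ t, a t) * ∫⁻ t, a t * b (x - t) ^ 2 := lintegral_mono h1
    _ = (∫⁻ t, a t) * ∫⁻ x, ∫⁻ t, a t * b (x - t) ^ 2 := by
        rw [lintegral_const_mul]
        apply Measurable.lintegral_prod_right'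
          (f := fun p : ℝ × ℝ => a p.2 * b (p.1 - p.2) ^ 2)
        fun_prop
    _ = (∫⁻ t, a t) * ∫⁻ t, ∫⁻ x, a t * b (x - t) ^ 2 := by
        rw [lintegral_lintegral_swap]
        apply Measurable.aemeasurable
        simp only [Function.uncurry_def]
        fun_prop
    _ = (∫⁻ t, a t) * ∫⁻ t, a t * ∫⁻ x, b x ^ 2 := by
        congr 2; ext t
        rw [lintegral_const_mul _ (by fun_prop)]
        rw [lintegral_sub_right_eq_self (fun x => b x ^ 2) t]
    _ = _ := by
        rw [lintegral_mul_const _ ha]; ring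

lemma young' {a b : ℝ → ℝ≥0∞} (ha : Measurable a) (hb : Measurable b) :
    ∫⁻ x, (∫⁻ t, a t * b (x - t)) ^ 2 ≤ (∫⁻ t, a t ^ 2) * (∫⁻ t, b t) ^ 2 := by
  have := young hb ha
  rw [mul_comm]
  refine le_trans (le_of_eq ?_) this
  congr 1; ext x
  rw [← lintegral_sub_left_eq_self _ x]
  simp [mul_comm]

lemma ft_eq (u : ℝ → ℂ) (ξ : ℝ) : ft u (2 * π * ξ) = 𝓕 u ξ := by
  unfold ft
  rw [Real.fourier_real_eq_integral_exp_smul]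
  congr 1; ext x
  rw [smul_eq_mul]
  congr 2
  push_cast; ring

lemma lam_eq (s : ℝ) (w : 𝓢(ℝ, ℂ)) (x : ℝ) :
    lam s w x = fourierMultiplierCLM ℂ (fun x => ((wt (s / 2) x : ℝ) : ℂ)) w x := by
  rw [fourierMultiplierCLM_apply, fourierInv_coe, Real.fourierInv_eq']
  unfold lam invFt
  have := Measure.integral_comp_mul_left
    (fun ξ : ℝ => Complex.exp (Complex.I * ξ * x) * ((((1 + ξ ^ 2) ^ (s / 2) : ℝ) : ℂ) * ft w ξ)) (2 * π)
  rw [abs_of_pos (by positivity)] at this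
  rw [← this]
  congr 1; ext ξ
  rw [smulLeftCLM_apply_apply (wtC_temperate _), ft_eq, smul_eq_mul, smul_eq_mul, wt, fourier_coe]
  congr 2
  simp
  ring

lemma fourier_pairing (f g : 𝓢(ℝ, ℂ)) (ξ : ℝ) :
    𝓕 (pairing (ContinuousLinearMap.mul ℂ ℂ) f g) ξ = ∫ t, 𝓕 f t * 𝓕 g (ξ - t) := by
  have h : 𝓕 (pairing (ContinuousLinearMap.mul ℂ ℂ) f g)
      = SchwartzMap.convolution (ContinuousLinearMap.mul ℂ ℂ) (𝓕 f) (𝓕 g) := by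
    have : pairing (ContinuousLinearMap.mul ℂ ℂ) f g
      = 𝓕⁻ (SchwartzMap.convolution (ContinuousLinearMap.mul ℂ ℂ) (𝓕 f) (𝓕 g)) := by
      ext x
      rw [fourierInv_apply_eq]
      simp only [compCLMOfContinuousLinearEquiv_apply, Function.comp]
      rw [fourier_convolution]
      simp only [pairing_apply_apply]
      have e : ∀ u : 𝓢(ℝ, ℂ), 𝓕 (𝓕 u) (-x) = u x := by
        intro u
        have : 𝓕⁻ (𝓕 u) x = u x := by simp
        rw [fourierInv_apply_eq] at this
        simpa using this
      simp [e]
    rw [this]; simp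
  rw [h, SchwartzMap.convolution_apply]
  simp [MeasureTheory.convolution]

lemma hs_eq (s : ℝ) (f : 𝓢(ℝ, ℂ)) :
    hsNorm s (ft f) = (2 * π * ∫ ξ, (wt (s / 2) ξ * ‖𝓕 f ξ‖) ^ 2) ^ ((1:ℝ)/2) := by
  unfold hsNorm
  congr 1
  have := Measure.integral_comp_mul_left
    (fun ξ : ℝ => (1 + ξ ^ 2) ^ s * ‖ft f ξ‖ ^ 2) (2 * π)
  rw [abs_of_pos (by positivity), smul_eq_mul, eq_comm, inv_mul_eq_iff_eq_mul₀ (by positivity)] at this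
  rw [this]
  congr 2; ext ξ
  rw [ft_eq, mul_pow (wt _ _), sq (wt _ _), wt_mul, wt, fourier_coe]
  congr 2; ring

lemma lint_eq (s : ℝ) (F : 𝓢(ℝ, ℂ)) :
    ∫⁻ ξ, ENNReal.ofReal (wt s ξ * ‖F ξ‖) ^ 2 = ENNReal.ofReal (∫ ξ, (wt s ξ * ‖F ξ‖) ^ 2) := by
  have hi : Integrable (fun ξ => (wt s ξ * ‖F ξ‖) ^ 2) := by
    have := (smulLeftCLM ℂ (fun x => ((wt s x : ℝ) : ℂ)) F).memLp 2 volume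
    have := this.integrable_norm_pow (by norm_num)
    convert this using 1
    ext ξ
    rw [smulLeftCLM_apply_apply (wtC_temperate _), norm_smul, Complex.norm_real,
      Real.norm_of_nonneg (wt_pos _ _).le]
  rw [ofReal_integral_eq_lintegral_ofReal hi (by filter_upwards with x using sq_nonneg _)]
  congr 1; ext ξ
  rw [ENNReal.ofReal_pow (mul_nonneg (wt_pos _ _).le (norm_nonneg _))]

lemma l1_bound (s : ℝ) (F : 𝓢(ℝ, ℂ)) :
    (∫⁻ ξ, ENNReal.ofReal (wt (1 / 2) ξ * ‖F ξ‖)) ^ 2 ≤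
      (∫⁻ ξ, ENNReal.ofReal (wt (1 - s) ξ)) * ∫⁻ ξ, ENNReal.ofReal (wt (s / 2) ξ * ‖F ξ‖) ^ 2 := by
  have hF := F.continuous
  have h1 := wt_cont (s/2)
  have h2 := wt_cont (1 / 2 - s/2)
  have := cs_lint (a := fun ξ => ENNReal.ofReal (wt (1 / 2 - s / 2) ξ))
    (b := fun ξ => ENNReal.ofReal (wt (s / 2) ξ * ‖F ξ‖)) (by fun_prop) (by fun_prop)
  convert this using 2
  · congr 1; ext ξ
    rw [← ENNReal.ofReal_mul (wt_pos _ _).le, ← mul_assoc, wt_mul]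
    congr 3; ring
  · congr 1; ext ξ
    rw [← ENNReal.ofReal_pow (wt_pos _ _).le, sq, wt_mul]
    congr 2; ring

lemma abs_le_wt (t : ℝ) : |2 * π * t| ≤ wt (1 / 2) t := by
  rw [wt, ← Real.sqrt_eq_rpow]
  exact Real.abs_le_sqrt (by linarith)

lemma kernel_bound (s : ℝ) (hs : 1 < s) (ξ t : ℝ) (p q : ℝ) (hp : 0 ≤ p) (hq : 0 ≤ q) :
    |wt (s / 2) ξ - wt (s / 2) (ξ - t)| * (p * (|2 * π * (ξ - t)| * q)) ≤
      s * 4 ^ ((s - 1) / 2) * ((wt (s / 2) t * p) * (wt (1 / 2) (ξ - t) * q) +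
        (wt (1 / 2) t * p) * (wt (s / 2) (ξ - t) * q)) := by
  have h := pointwise s hs (2 * π * ξ) (2 * π * (ξ - t))
  have e : 2 * π * ξ - 2 * π * (ξ - t) = 2 * π * t := by ring
  rw [e] at h
  have hC : 0 ≤ s * (4:ℝ) ^ ((s - 1) / 2) := by positivity
  have a1 := abs_le_wt t
  have a2 := abs_le_wt (ξ - t)
  have w1 : wt (s / 2) t = wt (1 / 2) t * wt ((s - 1) / 2) t := by
    rw [wt_mul]; congr 1; ring
  have w2 : wt (s / 2) (ξ - t) = wt (1 / 2) (ξ - t) * wt ((s - 1) / 2) (ξ - t) := by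
    rw [wt_mul]; congr 1; ring
  change |wt (s / 2) ξ - wt (s / 2) (ξ - t)| ≤ s * 4 ^ ((s - 1) / 2) *
    (|2 * π * t| * (wt ((s - 1) / 2) t + wt ((s - 1) / 2) (ξ - t))) at h
  have p1 := wt_pos ((s - 1) / 2) t
  have p2 := wt_pos ((s - 1) / 2) (ξ - t)
  have p3 := wt_pos (1 / 2) t
  calc _ ≤ (s * 4 ^ ((s - 1) / 2) *
      (wt (1 / 2) t * (wt ((s - 1) / 2) t + wt ((s - 1) / 2) (ξ - t)))) *
        (p * (wt (1 / 2) (ξ - t) * q)) := by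
        apply mul_le_mul (h.trans _) _ (by positivity) (by positivity)
        · gcongr
        · gcongr
    _ = _ := by rw [w1, w2]; ring

lemma sq_add_le (p q : ℝ≥0∞) : (p + q) ^ 2 ≤ 4 * (p ^ 2 + q ^ 2) := by
  rcases le_total p q with h | h
  · calc (p + q) ^ 2 ≤ (q + q) ^ 2 := by gcongr
      _ = 4 * q ^ 2 := by ring
      _ ≤ _ := by gcongr; exact le_add_self
  · calc (p + q) ^ 2 ≤ (p + p) ^ 2 := by gcongr
      _ = 4 * p ^ 2 := by ring
      _ ≤ _ := by gcongr; exact le_self_add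

lemma norm_fourier_deriv (g : 𝓢(ℝ, ℂ)) (t : ℝ) :
    ‖𝓕 (derivCLM ℂ ℂ g) t‖ = |2 * π * t| * ‖𝓕 g t‖ := by
  rw [fourier_coe, fourier_coe]
  have e : (derivCLM ℂ ℂ g : ℝ → ℂ) = deriv g := by ext x; simp
  have hi : Integrable (deriv g) := by rw [← e]; exact (derivCLM ℂ ℂ g).integrable
  rw [e, Real.fourier_deriv g.integrable g.differentiable hi]
  rw [norm_smul]
  congr 1
  simp [abs_mul]

lemma integrable_conv (F K : 𝓢(ℝ, ℂ)) (ξ : ℝ) : Integrable (fun t => F t * K (ξ - t)) := by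
  refine F.integrable.mul_bdd (c := SchwartzMap.seminorm ℝ 0 0 K) ?_ ?_
  · exact (K.continuous.comp (by fun_prop)).aestronglyMeasurable
  · filter_upwards with t using norm_le_seminorm ℝ K _

/-- The commutator as a Schwartz function. -/
noncomputable def comm (s : ℝ) (f k : 𝓢(ℝ, ℂ)) : 𝓢(ℝ, ℂ) :=
  fourierMultiplierCLM ℂ (fun x => ((wt (s / 2) x : ℝ) : ℂ))
      (pairing (ContinuousLinearMap.mul ℂ ℂ) f k) -
    pairing (ContinuousLinearMap.mul ℂ ℂ) f
      (fourierMultiplierCLM ℂ (fun x => ((wt (s / 2) x : ℝ) : ℂ)) k)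

lemma fourier_mult (s : ℝ) (k : 𝓢(ℝ, ℂ)) (ξ : ℝ) :
    𝓕 (fourierMultiplierCLM ℂ (fun x => ((wt (s / 2) x : ℝ) : ℂ)) k) ξ =
      (wt (s / 2) ξ : ℂ) * 𝓕 k ξ := by
  rw [fourierMultiplierCLM_apply, FourierTransform.fourier_fourierInv_eq,
    smulLeftCLM_apply_apply (wtC_temperate _), smul_eq_mul]

lemma fourier_comm (s : ℝ) (f k : 𝓢(ℝ, ℂ)) (ξ : ℝ) :
    𝓕 (comm s f k) ξ =
      ∫ t, ((wt (s / 2) ξ - wt (s / 2) (ξ - t) : ℝ) : ℂ) * (𝓕 f t * 𝓕 k (ξ - t)) := by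
  unfold comm
  rw [sub_eq_add_neg, FourierTransform.fourier_add, FourierTransform.fourier_neg, ← sub_eq_add_neg,
    SchwartzMap.sub_apply, fourier_mult, fourier_pairing, fourier_pairing,
    ← integral_const_mul, ← integral_sub]
  · congr 1; ext t
    rw [fourier_mult]
    push_cast; ring
  · exact (integrable_conv _ _ _).const_mul _
  · exact integrable_conv _ _ _

lemma main_bound (s : ℝ) (hs : 1 < s) (f g : 𝓢(ℝ, ℂ)) :
    ∫⁻ ξ, ‖𝓕 (comm s f (derivCLM ℂ ℂ g)) ξ‖ₑ ^ 2 ≤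
      ENNReal.ofReal (s * 4 ^ ((s - 1) / 2)) ^ 2 * (8 * ((∫⁻ ξ, ENNReal.ofReal (wt (1 - s) ξ)) *
        ((∫⁻ ξ, ENNReal.ofReal (wt (s / 2) ξ * ‖𝓕 f ξ‖) ^ 2) *
          (∫⁻ ξ, ENNReal.ofReal (wt (s / 2) ξ * ‖𝓕 g ξ‖) ^ 2)))) := by
  set A : ℝ → ℝ≥0∞ := fun ξ => ENNReal.ofReal (wt (s / 2) ξ * ‖𝓕 f ξ‖) with hA
  set B : ℝ → ℝ≥0∞ := fun ξ => ENNReal.ofReal (wt (s / 2) ξ * ‖𝓕 g ξ‖) with hB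
  set a : ℝ → ℝ≥0∞ := fun ξ => ENNReal.ofReal (wt (1 / 2) ξ * ‖𝓕 f ξ‖) with ha
  set b : ℝ → ℝ≥0∞ := fun ξ => ENNReal.ofReal (wt (1 / 2) ξ * ‖𝓕 g ξ‖) with hb
  set C : ℝ := s * 4 ^ ((s - 1) / 2) with hC
  have hC0 : 0 ≤ C := by positivity
  set J : ℝ≥0∞ := ∫⁻ ξ, ENNReal.ofReal (wt (1 - s) ξ)
  have hF := (𝓕 f).continuous
  have hG := (𝓕 g).continuous
  have h1 := wt_cont (s/2)
  have h2 := wt_cont (1/2)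
  have mA : Measurable A := by fun_prop
  have mB : Measurable B := by fun_prop
  have ma : Measurable a := by fun_prop
  have mb : Measurable b := by fun_prop
  have mconv : ∀ {u v : ℝ → ℝ≥0∞}, Measurable u → Measurable v →
      Measurable (fun ξ => ∫⁻ t, u t * v (ξ - t)) := by
    intro u v hu hv
    apply Measurable.lintegral_prod_right' (f := fun p : ℝ × ℝ => u p.2 * v (p.1 - p.2))
    fun_prop
  have pt : ∀ ξ, ‖𝓕 (comm s f (derivCLM ℂ ℂ g)) ξ‖ₑ ≤
      ENNReal.ofReal C * ((∫⁻ t, A t * b (ξ - t)) + ∫⁻ t, a t * B (ξ - t)) := by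
    intro ξ
    rw [fourier_comm]
    refine (enorm_integral_le_lintegral_enorm _).trans ?_
    rw [← lintegral_add_left (by fun_prop), ← lintegral_const_mul _ (by fun_prop)]
    refine lintegral_mono fun t => ?_
    have k := kernel_bound s hs ξ t ‖𝓕 f t‖ ‖𝓕 g (ξ - t)‖ (norm_nonneg _) (norm_nonneg _)
    have w1 := (wt_pos (s/2) t).le
    have w2 := (wt_pos (1/2) t).le
    have w3 := (wt_pos (s/2) (ξ - t)).le
    have w4 := (wt_pos (1/2) (ξ - t)).le
    simp only [hA, hB, ha, hb]
    rw [← ENNReal.ofReal_mul (by positivity), ← ENNReal.ofReal_mul (by positivity),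
      ← ENNReal.ofReal_add (by positivity) (by positivity), ← ENNReal.ofReal_mul hC0,
      ← ofReal_norm]
    refine ENNReal.ofReal_le_ofReal ?_
    rw [norm_mul, norm_mul, Complex.norm_real, Real.norm_eq_abs, norm_fourier_deriv]
    exact k
  calc _ ≤ ∫⁻ ξ, ENNReal.ofReal C ^ 2 * (4 * ((∫⁻ t, A t * b (ξ - t)) ^ 2 +
        (∫⁻ t, a t * B (ξ - t)) ^ 2)) := by
        refine lintegral_mono fun ξ => ?_
        refine (pow_le_pow_left' (pt ξ) 2).trans ?_
        rw [mul_pow]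
        gcongr
        exact sq_add_le _ _
    _ = ENNReal.ofReal C ^ 2 * (4 * ((∫⁻ ξ, (∫⁻ t, A t * b (ξ - t)) ^ 2) +
        ∫⁻ ξ, (∫⁻ t, a t * B (ξ - t)) ^ 2)) := by
        have m1 := mconv mA mb
        have m2 := mconv ma mB
        rw [lintegral_const_mul _ (by fun_prop), lintegral_const_mul _ (by fun_prop),
          lintegral_add_left (by fun_prop)]
    _ ≤ ENNReal.ofReal C ^ 2 * (4 * ((∫⁻ t, A t ^ 2) * (∫⁻ t, b t) ^ 2 +
        (∫⁻ t, a t) ^ 2 * ∫⁻ t, B t ^ 2)) := by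
        gcongr
        · exact young' mA mb
        · exact young ma mB
    _ ≤ ENNReal.ofReal C ^ 2 * (4 * ((∫⁻ t, A t ^ 2) * (J * ∫⁻ t, B t ^ 2) +
        (J * ∫⁻ t, A t ^ 2) * ∫⁻ t, B t ^ 2)) := by
        gcongr
        · exact l1_bound s (𝓕 g)
        · exact l1_bound s (𝓕 f)
    _ = _ := by ring

lemma main_real (s : ℝ) (hs : 3 / 2 < s) : ∃ D : ℝ, 0 < D ∧ ∀ f g : 𝓢(ℝ, ℂ),
    ∫ x, ‖comm s f (derivCLM ℂ ℂ g) x‖ ^ 2 ≤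
      D * ((∫ ξ, (wt (s / 2) ξ * ‖𝓕 f ξ‖) ^ 2) * ∫ ξ, (wt (s / 2) ξ * ‖𝓕 g ξ‖) ^ 2) := by
  have hJ : ∫⁻ ξ, ENNReal.ofReal (wt (1 - s) ξ) = ENNReal.ofReal (∫ ξ, wt (1 - s) ξ) := by
    rw [ofReal_integral_eq_lintegral_ofReal (wt_integrable (by linarith))]
    filter_upwards with x using (wt_pos _ _).le
  have hJ0 : 0 ≤ ∫ ξ, wt (1 - s) ξ := integral_nonneg fun x => (wt_pos _ _).le
  refine ⟨(s * 4 ^ ((s - 1) / 2)) ^ 2 * (8 * (∫ ξ, wt (1 - s) ξ)) + 1, by positivity, ?_⟩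
  intro f g
  set NF := ∫ ξ, (wt (s / 2) ξ * ‖𝓕 f ξ‖) ^ 2
  set NG := ∫ ξ, (wt (s / 2) ξ * ‖𝓕 g ξ‖) ^ 2
  have hNF : 0 ≤ NF := integral_nonneg fun x => sq_nonneg _
  have hNG : 0 ≤ NG := integral_nonneg fun x => sq_nonneg _
  have h := main_bound s (by linarith) f g
  rw [lint_eq, lint_eq, hJ] at h
  have hs0 : 0 ≤ s * (4:ℝ) ^ ((s - 1) / 2) := by
    have : 0 ≤ s := by linarith
    positivity
  have e8 : (8 : ℝ≥0∞) = ENNReal.ofReal 8 := by norm_num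
  rw [e8, ← ENNReal.ofReal_pow hs0, ← ENNReal.ofReal_mul hNF, ← ENNReal.ofReal_mul hJ0,
    ← ENNReal.ofReal_mul (by norm_num), ← ENNReal.ofReal_mul (by positivity)] at h
  rw [← integral_norm_sq_fourier]
  set H := 𝓕 (comm s f (derivCLM ℂ ℂ g))
  have hi : Integrable (fun ξ => ‖H ξ‖ ^ 2) :=
    (H.memLp 2 volume).integrable_norm_pow (by norm_num)
  have e : ∫⁻ ξ, ‖H ξ‖ₑ ^ 2 = ENNReal.ofReal (∫ ξ, ‖H ξ‖ ^ 2) := by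
    rw [ofReal_integral_eq_lintegral_ofReal hi (by filter_upwards with x using sq_nonneg _)]
    congr 1; ext ξ
    rw [ENNReal.ofReal_pow (norm_nonneg _), ofReal_norm]
  rw [e, ENNReal.ofReal_le_ofReal_iff (by positivity)] at h
  refine h.trans ?_
  have : 0 ≤ NF * NG := by positivity
  linarith

end CommAux

/-- for `s > 3/2` there is a constant `C` such that for all
`f, g ∈ H^s(ℝ)` (here: Schwartz functions, measured in the `H^s` norm) the
commutator `[Λ^s, f] D_x g = Λ^s(f·g') − f·Λ^s(g')` satisfies
`‖[Λ^s, f] D_x g‖_{L²} ≤ C ‖f‖_{H^s} ‖g‖_{H^s}`. -/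
theorem commutator_estimate (s : ℝ) (hs : 3 / 2 < s) :
    ∃ C : ℝ, 0 < C ∧ ∀ f g : SchwartzMap ℝ ℂ,
      (∫ x : ℝ, ‖lam s (fun z => f z * deriv (⇑g) z) x - f x * lam s (deriv ⇑g) x‖ ^ 2) ^
          ((1 : ℝ) / 2)
        ≤ C * hsNorm s (ft ⇑f) * hsNorm s (ft ⇑g) := by
  obtain ⟨D, hD, h⟩ := CommAux.main_real s hs
  refine ⟨D ^ ((1:ℝ)/2), by positivity, fun f g => ?_⟩
  have e : ∀ x, lam s (fun z => f z * deriv (⇑g) z) x - f x * lam s (deriv ⇑g) x =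
      CommAux.comm s f (SchwartzMap.derivCLM ℂ ℂ g) x := by
    intro x
    have e1 : (deriv ⇑g) = (SchwartzMap.derivCLM ℂ ℂ g : ℝ → ℂ) := by ext x; simp
    have e2 : (fun z => f z * deriv (⇑g) z) = (SchwartzMap.pairing (ContinuousLinearMap.mul ℂ ℂ) f
      (SchwartzMap.derivCLM ℂ ℂ g) : ℝ → ℂ) := by ext x; simp
    rw [e2, e1, CommAux.lam_eq, CommAux.lam_eq, CommAux.comm]
    simp
  simp only [e]
  have hf : 0 ≤ ∫ ξ, (CommAux.wt (s / 2) ξ * ‖FourierTransform.fourier f ξ‖) ^ 2 :=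
    integral_nonneg fun x => sq_nonneg _
  have hg : 0 ≤ ∫ ξ, (CommAux.wt (s / 2) ξ * ‖FourierTransform.fourier g ξ‖) ^ 2 :=
    integral_nonneg fun x => sq_nonneg _
  have hpi := Real.pi_gt_three
  rw [CommAux.hs_eq, CommAux.hs_eq, ← Real.mul_rpow (by positivity) (by positivity),
    ← Real.mul_rpow (by positivity) (by positivity)]
  refine Real.rpow_le_rpow (integral_nonneg fun x => sq_nonneg _) ((h f g).trans ?_) (by norm_num)
  rw [mul_assoc]
  refine mul_le_mul_of_nonneg_left ?_ hD.le
  apply mul_le_mul _ _ hg (by positivity)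
  · nlinarith
  · nlinarith
end

section
/- Let g be a C^∞ function on ℝ with g(0) = 0, and let s > 3/2. For every R > 0 there is a constant C₂ = C₂(g, R) such that for all u, v ∈ H^s(ℝ) with ‖u‖_{H^s} ≤ R and ‖v‖_{H^s} ≤ R, one has ‖g(u) − g(v)‖_{H^s} ≤ C₂ ‖u − v‖_{H^s}, where g(u) denotes the composition x ↦ g(u(x)). -/
open MeasureTheory

/-- Membership in `H^s(ℝ)` (for integrable representatives): `u ∈ L¹`, the weighted
square of `û` is integrable, and `u` is recovered from `û` by Fourier inversion. -/
def MemHs (s : ℝ) (u : ℝ → ℂ) : Prop :=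
  Integrable u ∧
    Integrable (fun ξ : ℝ => (1 + ξ ^ 2) ^ s * ‖ft u ξ‖ ^ 2) ∧
    ∀ x : ℝ, u x = invFt (ft u) x

open ENNReal in
/-- Japanese-bracket weight. -/
noncomputable def wJ (s ξ : ℝ) : ℝ≥0∞ := ENNReal.ofReal ((1 + ξ ^ 2) ^ s)

open ENNReal in
/-- Squared Sobolev norm on the Fourier side. -/
noncomputable def hN (s : ℝ) (U : ℝ → ℂ) : ℝ≥0∞ := ∫⁻ ξ, wJ s ξ * ‖U ξ‖ₑ ^ 2

lemma wJ_base (ξ : ℝ) : 1 ≤ 1 + ξ ^ 2 := by nlinarith [sq_nonneg ξ]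

lemma wJ_mul (a b ξ : ℝ) : wJ a ξ * wJ b ξ = wJ (a + b) ξ := by
  have := wJ_base ξ
  unfold wJ
  rw [← ENNReal.ofReal_mul (by positivity), ← Real.rpow_add (by positivity)]

lemma wJ_zero (ξ : ℝ) : wJ 0 ξ = 1 := by simp [wJ]

lemma wJ_mono {a b : ℝ} (h : a ≤ b) (ξ : ℝ) : wJ a ξ ≤ wJ b ξ :=
  ENNReal.ofReal_le_ofReal (Real.rpow_le_rpow_of_exponent_le (wJ_base ξ) h)

lemma wJ_sq (a ξ : ℝ) : wJ (a / 2) ξ ^ 2 = wJ a ξ := by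
  rw [sq, wJ_mul]; congr 1; ring

lemma measurable_wJ (s : ℝ) : Measurable (wJ s) := by
  unfold wJ; fun_prop

lemma wJ_succ (s ξ : ℝ) (U : ℂ) :
    wJ (s + 1) ξ * ‖U‖ₑ ^ 2 = wJ s ξ * ‖U‖ₑ ^ 2 + wJ s ξ * ‖Complex.I * ξ * U‖ₑ ^ 2 := by
  have h1 := wJ_base ξ
  have : wJ (s + 1) ξ = wJ s ξ + wJ s ξ * ‖ξ‖ₑ ^ 2 := by
    unfold wJ
    rw [← ofReal_norm, ← ENNReal.ofReal_pow (by positivity), ← ENNReal.ofReal_mul (by positivity),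
      ← ENNReal.ofReal_add (by positivity) (by positivity), Real.rpow_add_one (by positivity)]
    congr 1
    simp
    ring
  rw [this, enorm_mul, enorm_mul, mul_pow, mul_pow]
  have e1 : ‖Complex.I‖ₑ = 1 := by rw [← ofReal_norm]; simp
  have e2 : ‖(ξ : ℂ)‖ₑ = ‖ξ‖ₑ := by rw [← ofReal_norm, ← ofReal_norm]; simp
  rw [e1, e2]; ring

lemma hN_mono {a b : ℝ} (h : a ≤ b) (U : ℝ → ℂ) : hN a U ≤ hN b U :=
  lintegral_mono fun ξ => mul_le_mul' (wJ_mono h ξ) le_rfl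

lemma hN_succ (s : ℝ) (U : ℝ → ℂ) (hU : Measurable U) :
    hN (s + 1) U = hN s U + hN s (fun ξ => Complex.I * ξ * U ξ) := by
  unfold hN
  simp_rw [wJ_succ]
  rw [lintegral_add_left]
  exact (measurable_wJ s).mul (by fun_prop)

lemma enorm_add_sq_le (a b : ℂ) : ‖a + b‖ₑ ^ 2 ≤ 2 * ‖a‖ₑ ^ 2 + 2 * ‖b‖ₑ ^ 2 := by
  rw [← ofReal_norm, ← ofReal_norm, ← ofReal_norm, ← ENNReal.ofReal_pow (by positivity),
    ← ENNReal.ofReal_pow (by positivity), ← ENNReal.ofReal_pow (by positivity),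
    ← ENNReal.ofReal_ofNat 2, ← ENNReal.ofReal_mul (by positivity),
    ← ENNReal.ofReal_mul (by positivity), ← ENNReal.ofReal_add (by positivity) (by positivity)]
  apply ENNReal.ofReal_le_ofReal
  have := norm_add_le a b
  have h2 : ‖a + b‖ ^ 2 ≤ (‖a‖ + ‖b‖) ^ 2 := by gcongr
  nlinarith [sq_nonneg (‖a‖ - ‖b‖)]

lemma hN_add (s : ℝ) (U V : ℝ → ℂ) (hU : Measurable U) :
    hN s (fun ξ => U ξ + V ξ) ≤ 2 * hN s U + 2 * hN s V := by
  unfold hN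
  rw [← lintegral_const_mul' _ _ (by simp), ← lintegral_const_mul' _ _ (by simp),
    ← lintegral_add_left]
  · refine lintegral_mono fun ξ => ?_
    calc _ ≤ wJ s ξ * (2 * ‖U ξ‖ₑ ^ 2 + 2 * ‖V ξ‖ₑ ^ 2) := by gcongr; exact enorm_add_sq_le _ _
      _ = _ := by ring
  · have := measurable_wJ s
    fun_prop

lemma hN_const_mul (s : ℝ) (c : ℂ) (U : ℝ → ℂ) :
    hN s (fun ξ => c * U ξ) = ‖c‖ₑ ^ 2 * hN s U := by
  unfold hN
  rw [← lintegral_const_mul' _ _ (by simp)]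
  congr 1; ext ξ
  rw [enorm_mul]; ring

lemma wJ_integrable {r : ℝ} (hr : 1 / 2 < r) : ∫⁻ ξ, wJ (-r) ξ ≠ ⊤ := by
  have h := integrable_rpow_neg_one_add_norm_sq (E := ℝ) (μ := volume) (r := 2 * r)
    (by simp; linarith)
  have h2 := h.lintegral_lt_top
  refine ne_of_lt (lt_of_le_of_lt (le_of_eq ?_) h2)
  congr 1; ext ξ
  unfold wJ
  congr 2
  · simp
  · ring

lemma wJ_le {t : ℝ} (ht : 0 ≤ t) (a b : ℝ) :
    wJ t (a + b) ≤ ENNReal.ofReal (4 ^ t) * (wJ t a + wJ t b) := by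
  unfold wJ
  have ha := wJ_base a
  have hb := wJ_base b
  have hab := wJ_base (a + b)
  rw [← ENNReal.ofReal_add (by positivity) (by positivity), ← ENNReal.ofReal_mul (by positivity)]
  apply ENNReal.ofReal_le_ofReal
  rcases le_total (a ^ 2) (b ^ 2) with h | h
  · calc (1 + (a + b) ^ 2) ^ t ≤ (4 * (1 + b ^ 2)) ^ t := by
          gcongr; nlinarith [sq_nonneg (a - b)]
      _ = 4 ^ t * (1 + b ^ 2) ^ t := Real.mul_rpow (by positivity) (by positivity)
      _ ≤ _ := by gcongr; simp; positivity
  · calc (1 + (a + b) ^ 2) ^ t ≤ (4 * (1 + a ^ 2)) ^ t := by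
          gcongr; nlinarith [sq_nonneg (a - b)]
      _ = 4 ^ t * (1 + a ^ 2) ^ t := Real.mul_rpow (by positivity) (by positivity)
      _ ≤ _ := by gcongr; simp; positivity

lemma wJ_anti {q : ℝ} (hq : q ≤ 0) {a b : ℝ} (h : a ^ 2 ≤ b ^ 2) : wJ q b ≤ wJ q a := by
  unfold wJ
  have ha := wJ_base a
  exact ENNReal.ofReal_le_ofReal (Real.rpow_le_rpow_of_nonpos (by positivity) (by linarith) hq)

lemma wJ_kernel {t r : ℝ} (ht : 0 ≤ t) (htr : t ≤ r) (a b : ℝ) :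
    wJ t (a + b) * (wJ (-r) a * wJ (-t) b) ≤
      ENNReal.ofReal (4 ^ t) * (2 * wJ (-r) a + wJ (-r) b) := by
  have h1 : wJ t a * (wJ (-r) a * wJ (-t) b) ≤ wJ (-r) a + wJ (-r) b := by
    rw [← mul_assoc, wJ_mul]
    rcases le_total (a ^ 2) (b ^ 2) with h | h
    · calc _ ≤ wJ (t + -r) a * wJ (-t) a := by gcongr; exact wJ_anti (by linarith) h
        _ = wJ (-r) a := by rw [wJ_mul]; congr 1; ring
        _ ≤ _ := le_self_add
    · calc _ ≤ wJ (t + -r) b * wJ (-t) b := by gcongr; exact wJ_anti (by linarith) h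
        _ = wJ (-r) b := by rw [wJ_mul]; congr 1; ring
        _ ≤ _ := le_add_self
  have h2 : wJ t b * (wJ (-r) a * wJ (-t) b) = wJ (-r) a := by
    rw [mul_comm (wJ (-r) a), ← mul_assoc, wJ_mul]; simp [wJ_zero]
  calc _ ≤ ENNReal.ofReal (4 ^ t) * (wJ t a + wJ t b) * (wJ (-r) a * wJ (-t) b) := by
        gcongr; exact wJ_le ht a b
    _ = ENNReal.ofReal (4 ^ t) * (wJ t a * (wJ (-r) a * wJ (-t) b)
        + wJ t b * (wJ (-r) a * wJ (-t) b)) := by ring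
    _ ≤ ENNReal.ofReal (4 ^ t) * (wJ (-r) a + wJ (-r) b + wJ (-r) a) := by
        rw [h2]; gcongr
    _ = _ := by ring

lemma cs_sq (f g : ℝ → ENNReal) (hf : Measurable f) (hg : Measurable g) :
    (∫⁻ x, f x * g x) ^ 2 ≤ (∫⁻ x, f x ^ 2) * ∫⁻ x, g x ^ 2 := by
  have h := ENNReal.lintegral_mul_le_Lp_mul_Lq volume Real.HolderConjugate.two_two
    hf.aemeasurable hg.aemeasurable
  calc _ ≤ ((∫⁻ x, f x ^ (2 : ℝ)) ^ (1 / 2 : ℝ) * (∫⁻ x, g x ^ (2 : ℝ)) ^ (1 / 2 : ℝ)) ^ 2 := by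
        gcongr; exact h
    _ = _ := by
        rw [mul_pow, ← ENNReal.rpow_natCast, ← ENNReal.rpow_natCast, ← ENNReal.rpow_mul,
          ← ENNReal.rpow_mul]
        norm_num

lemma hN_L1 {r : ℝ} (U : ℝ → ℂ) (hU : Measurable U) :
    (∫⁻ ξ, ‖U ξ‖ₑ) ^ 2 ≤ (∫⁻ ξ, wJ (-r) ξ) * hN r U := by
  have h := cs_sq (fun ξ => wJ (-r / 2) ξ) (fun ξ => wJ (r / 2) ξ * ‖U ξ‖ₑ)
    (measurable_wJ _) ((measurable_wJ _).mul (by fun_prop))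
  simp_rw [← mul_assoc, wJ_mul, mul_pow, wJ_sq] at h
  have e : -r / 2 + r / 2 = 0 := by ring
  simpa [e, wJ_zero, hN] using h

/-- Product estimate on the Fourier side. -/
lemma hN_conv {t r : ℝ} (ht : 0 ≤ t) (htr : t ≤ r) (hr : 1 / 2 < r) :
    ∃ K : ENNReal, K ≠ ⊤ ∧ ∀ F W : ℝ → ℂ, Measurable F → Measurable W →
      hN t (fun ξ => ∫ η, F (ξ - η) * W η) ≤ K * hN r F * hN t W := by
  refine ⟨ENNReal.ofReal (4 ^ t) * (3 * ∫⁻ ξ, wJ (-r) ξ), ?_, ?_⟩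
  · have := wJ_integrable hr
    finiteness
  intro F W hF hW
  set K := ENNReal.ofReal (4 ^ t) * (3 * ∫⁻ ξ, wJ (-r) ξ) with hK
  have mJ := measurable_wJ
  have hker (ξ : ℝ) : wJ t ξ * ∫⁻ η, wJ (-r) (ξ - η) * wJ (-t) η ≤ K := by
    have m1 : Measurable fun η => wJ (-r) (ξ - η) := (mJ _).comp (by fun_prop)
    have m2 : Measurable fun η => wJ (-r) (ξ - η) * wJ (-t) η := m1.mul (mJ _)
    rw [← lintegral_const_mul _ m2]
    calc _ ≤ ∫⁻ η, ENNReal.ofReal (4 ^ t) * (2 * wJ (-r) (ξ - η) + wJ (-r) η) := by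
          refine lintegral_mono fun η => ?_
          have := wJ_kernel ht htr (ξ - η) η
          rwa [sub_add_cancel] at this
      _ = _ := by
          rw [lintegral_const_mul' _ _ (by simp), lintegral_add_left (m1.const_mul _),
            lintegral_const_mul' _ _ (by simp), lintegral_sub_left_eq_self (wJ (-r)) ξ, hK]
          ring
  have hpt (ξ : ℝ) : wJ t ξ * ‖∫ η, F (ξ - η) * W η‖ₑ ^ 2 ≤
      K * ∫⁻ η, (wJ r (ξ - η) * ‖F (ξ - η)‖ₑ ^ 2) * (wJ t η * ‖W η‖ₑ ^ 2) := by
    have m1 (q : ℝ) : Measurable fun η => wJ q (ξ - η) := (mJ _).comp (by fun_prop)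
    have h := cs_sq (fun η => wJ (-r / 2) (ξ - η) * wJ (-t / 2) η)
      (fun η => (wJ (r / 2) (ξ - η) * ‖F (ξ - η)‖ₑ) * (wJ (t / 2) η * ‖W η‖ₑ))
      ((m1 _).mul (mJ _)) (((m1 _).mul (by fun_prop)).mul ((mJ _).mul (by fun_prop)))
    have e (η : ℝ) : wJ (-r / 2) (ξ - η) * wJ (-t / 2) η *
      ((wJ (r / 2) (ξ - η) * ‖F (ξ - η)‖ₑ) * (wJ (t / 2) η * ‖W η‖ₑ)) =
        ‖F (ξ - η) * W η‖ₑ := by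
      calc _ = (wJ (-r / 2) (ξ - η) * wJ (r / 2) (ξ - η)) * (wJ (-t / 2) η * wJ (t / 2) η)
            * (‖F (ξ - η)‖ₑ * ‖W η‖ₑ) := by ring
        _ = _ := by
          rw [wJ_mul, wJ_mul, show -r / 2 + r / 2 = 0 by ring, show -t / 2 + t / 2 = 0 by ring,
            wJ_zero, wJ_zero, enorm_mul]; simp
    simp_rw [e, mul_pow, wJ_sq] at h
    calc _ ≤ wJ t ξ * (∫⁻ η, ‖F (ξ - η) * W η‖ₑ) ^ 2 := by
          gcongr; exact enorm_integral_le_lintegral_enorm _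
      _ ≤ wJ t ξ * (_ * _) := by gcongr
      _ ≤ _ := by rw [← mul_assoc]; gcongr; exact hker ξ
  have mF : Measurable fun x => wJ r x * ‖F x‖ₑ ^ 2 := (mJ r).mul (by fun_prop)
  have mW : Measurable fun x => wJ t x * ‖W x‖ₑ ^ 2 := (mJ t).mul (by fun_prop)
  calc hN t (fun ξ => ∫ η, F (ξ - η) * W η) ≤ ∫⁻ ξ, K *
        ∫⁻ η, (wJ r (ξ - η) * ‖F (ξ - η)‖ₑ ^ 2) * (wJ t η * ‖W η‖ₑ ^ 2) :=
        lintegral_mono hpt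
    _ = K * ∫⁻ ξ, ∫⁻ η, (wJ r (ξ - η) * ‖F (ξ - η)‖ₑ ^ 2) * (wJ t η * ‖W η‖ₑ ^ 2) := by
        rw [lintegral_const_mul' _ _ (by have := wJ_integrable hr; rw [hK]; finiteness)]
    _ = K * ∫⁻ η, ∫⁻ ξ, (wJ r (ξ - η) * ‖F (ξ - η)‖ₑ ^ 2) * (wJ t η * ‖W η‖ₑ ^ 2) := by
        rw [lintegral_lintegral_swap]
        refine Measurable.aemeasurable ?_
        exact (mF.comp (measurable_fst.sub measurable_snd)).mul (mW.comp measurable_snd)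
    _ = K * (hN r F * hN t W) := by
        congr 1
        unfold hN
        rw [← lintegral_const_mul _ mW]
        congr 1; ext η
        have m3 : Measurable fun ξ => wJ r (ξ - η) * ‖F (ξ - η)‖ₑ ^ 2 :=
          mF.comp (measurable_id.sub_const η)
        rw [lintegral_mul_const _ m3]
        congr 1
        exact lintegral_sub_right_eq_self (fun x => wJ r x * ‖F x‖ₑ ^ 2) η
    _ = _ := by ring


open FourierTransform in
lemma ft_eq (u : ℝ → ℂ) (ξ : ℝ) : ft u ξ = 𝓕 u (ξ / (2 * Real.pi)) := by
  rw [Real.fourier_real_eq_integral_exp_smul]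
  unfold ft
  congr 1; ext x
  rw [smul_eq_mul]
  congr 2
  have : (Real.pi : ℂ) ≠ 0 := by exact_mod_cast Real.pi_ne_zero
  push_cast
  field_simp

lemma invFt_eq (U : ℝ → ℂ) (x : ℝ) : invFt U x = (2 * Real.pi : ℝ)⁻¹ • ft U (-x) := by
  unfold invFt ft
  congr 2; ext ξ
  congr 2
  push_cast; ring

lemma enorm_cexp_I (ξ x : ℝ) : ‖Complex.exp (-(Complex.I * ξ * x))‖ = 1 := by
  rw [show -(Complex.I * ξ * x) = ((-(ξ * x) : ℝ) : ℂ) * Complex.I by push_cast; ring]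
  exact Complex.norm_exp_ofReal_mul_I _

lemma ft_integrand (u : ℝ → ℂ) (hu : Integrable u) (ξ : ℝ) :
    Integrable (fun x : ℝ => Complex.exp (-(Complex.I * ξ * x)) * u x) := by
  refine hu.bdd_mul (c := 1) (by fun_prop) ?_
  exact Filter.Eventually.of_forall fun x => (enorm_cexp_I ξ x).le

lemma ft_continuous (u : ℝ → ℂ) (hu : Integrable u) : Continuous (ft u) := by
  unfold ft
  refine continuous_of_dominated (bound := fun x => ‖u x‖) ?_ ?_ hu.norm ?_
  · intro ξ; exact (ft_integrand u hu ξ).aestronglyMeasurable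
  · intro ξ; refine Filter.Eventually.of_forall fun x => ?_
    rw [norm_mul, enorm_cexp_I, one_mul]
  · refine Filter.Eventually.of_forall fun x => ?_
    fun_prop

lemma ft_add (u v : ℝ → ℂ) (hu : Integrable u) (hv : Integrable v) (ξ : ℝ) :
    ft (fun x => u x + v x) ξ = ft u ξ + ft v ξ := by
  unfold ft
  rw [← integral_add (ft_integrand u hu ξ) (ft_integrand v hv ξ)]
  congr 1; ext x; ring

lemma ft_sub (u v : ℝ → ℂ) (hu : Integrable u) (hv : Integrable v) (ξ : ℝ) :
    ft (fun x => u x - v x) ξ = ft u ξ - ft v ξ := by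
  unfold ft
  rw [← integral_sub (ft_integrand u hu ξ) (ft_integrand v hv ξ)]
  congr 1; ext x; ring

lemma ft_const_mul (c : ℂ) (u : ℝ → ℂ) (ξ : ℝ) :
    ft (fun x => c * u x) ξ = c * ft u ξ := by
  unfold ft
  rw [← integral_const_mul]
  congr 1; ext x; ring

lemma invFt_sub (u v : ℝ → ℂ) (hu : Integrable u) (hv : Integrable v) (x : ℝ) :
    invFt (fun ξ => u ξ - v ξ) x = invFt u x - invFt v x := by
  rw [invFt_eq, invFt_eq, invFt_eq, ft_sub u v hu hv, smul_sub]

lemma ft_enorm_le (u : ℝ → ℂ) (ξ : ℝ) : ‖ft u ξ‖ₑ ≤ ∫⁻ x, ‖u x‖ₑ := by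
  unfold ft
  refine (enorm_integral_le_lintegral_enorm _).trans (lintegral_mono fun x => ?_)
  rw [enorm_mul, ← ofReal_norm, enorm_cexp_I]; simp

lemma two_pi_inv_enorm_le : ‖(2 * Real.pi : ℝ)⁻¹‖ₑ ≤ 1 := by
  rw [← ofReal_norm, ENNReal.ofReal_le_one, norm_inv, Real.norm_of_nonneg (by positivity)]
  exact inv_le_one_of_one_le₀ (by linarith [Real.pi_gt_three])

lemma invFt_enorm_le (u : ℝ → ℂ) (x : ℝ) : ‖invFt u x‖ₑ ≤ ∫⁻ ξ, ‖u ξ‖ₑ := by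
  rw [invFt_eq, enorm_smul]
  calc _ ≤ 1 * ∫⁻ ξ, ‖u ξ‖ₑ := mul_le_mul' two_pi_inv_enorm_le (ft_enorm_le _ _)
    _ = _ := one_mul _

lemma invFt_continuous (u : ℝ → ℂ) (hu : Integrable u) : Continuous (invFt u) := by
  have := ft_continuous u hu
  have e : invFt u = fun x => (2 * Real.pi : ℝ)⁻¹ • ft u (-x) := funext (invFt_eq u)
  rw [e]; fun_prop

lemma ft_mul_invFt (h W : ℝ → ℂ) (hh : Integrable h) (hW : Integrable W) (ξ : ℝ) :
    ft (fun x => h x * invFt W x) ξ =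
      ((2 * Real.pi : ℝ)⁻¹ : ℂ) * ∫ η, ft h (ξ - η) * W η := by
  have hI : Integrable (Function.uncurry fun x η : ℝ =>
      Complex.exp (-(Complex.I * ξ * x)) * Complex.exp (Complex.I * η * x) * (h x * W η))
      (volume.prod volume) := by
    refine (hh.mul_prod hW).bdd_mul (c := 1) (by fun_prop) ?_
    refine Filter.Eventually.of_forall fun p => ?_
    rw [norm_mul, enorm_cexp_I, one_mul]
    have := enorm_cexp_I (-p.2) p.1
    push_cast at this
    rw [show Complex.I * (p.2 : ℂ) * p.1 = -(Complex.I * -(p.2 : ℂ) * p.1) by ring, this]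
  have hs := integral_integral_swap hI
  unfold ft invFt
  calc _ = ∫ x : ℝ, ((2 * Real.pi : ℝ)⁻¹ : ℂ) * ∫ η : ℝ,
      Complex.exp (-(Complex.I * ξ * x)) * Complex.exp (Complex.I * η * x) * (h x * W η) := by
        congr 1; ext x
        have : ∀ η : ℝ, Complex.exp (-(Complex.I * ξ * x)) * Complex.exp (Complex.I * η * x)
          * (h x * W η) = (Complex.exp (-(Complex.I * ξ * x)) * h x) *
            (Complex.exp (Complex.I * η * x) * W η) := fun η => by ring
        simp_rw [this]
        rw [integral_const_mul, Complex.real_smul]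
        push_cast; ring
    _ = _ := by
        rw [integral_const_mul, hs]
        congr 2; ext η
        rw [← integral_mul_const]
        congr 1; ext x
        rw [show -(Complex.I * ((ξ - η : ℝ) : ℂ) * x) =
          -(Complex.I * ξ * x) + Complex.I * η * x by push_cast; ring, Complex.exp_add]
        ring

open FourierTransform in
lemma invFt_hasDerivAt (U : ℝ → ℂ) (hU : Integrable U)
    (hU' : Integrable (fun ξ : ℝ => Complex.I * ξ * U ξ)) (x : ℝ) :
    HasDerivAt (invFt U) (invFt (fun ξ : ℝ => Complex.I * ξ * U ξ) x) x := by
  have h2 : Integrable (fun ξ : ℝ => ξ • U ξ) := by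
    have := hU'.const_mul (-Complex.I)
    refine this.congr (Filter.Eventually.of_forall fun ξ => ?_)
    simp only [Complex.real_smul]
    linear_combination (-(ξ : ℂ) * U ξ) * Complex.I_mul_I
  have h := Real.hasDerivAt_fourier hU h2 (-x / (2 * Real.pi))
  have h3 : HasDerivAt (fun x : ℝ => -x / (2 * Real.pi)) (-1 / (2 * Real.pi)) x :=
    (hasDerivAt_neg x).div_const _
  have h4 := (h.scomp x h3).const_smul ((2 * Real.pi : ℝ)⁻¹)
  have e : invFt U = fun x => (2 * Real.pi : ℝ)⁻¹ • 𝓕 U (-x / (2 * Real.pi)) := by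
    ext x; rw [invFt_eq, ft_eq]
  rw [e]
  refine h4.congr_deriv ?_
  rw [invFt_eq, ft_eq]
  congr 1
  rw [Real.fourier_real_eq, Real.fourier_real_eq, ← integral_smul]
  congr 1; ext ξ
  simp only [Circle.smul_def, smul_eq_mul, Complex.real_smul]
  have : (Real.pi : ℂ) ≠ 0 := by exact_mod_cast Real.pi_ne_zero
  push_cast
  field_simp

open FourierTransform in
lemma ft_deriv (f f' : ℝ → ℂ) (hf : Integrable f) (hf' : Integrable f')
    (hd : ∀ x, HasDerivAt f (f' x) x) (ξ : ℝ) : ft f' ξ = Complex.I * ξ * ft f ξ := by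
  have e : deriv f = f' := funext fun x => (hd x).deriv
  have h := Real.fourier_deriv hf (fun x => (hd x).differentiableAt) (e ▸ hf')
  rw [ft_eq, ft_eq, ← e, h]
  have : (Real.pi : ℂ) ≠ 0 := by exact_mod_cast Real.pi_ne_zero
  simp only [smul_eq_mul]
  push_cast
  field_simp

open FourierTransform SchwartzMap in
lemma fourier_L2_ae (f : ℝ → ℂ) (hf : Integrable f) (h2 : MemLp f 2 volume) :
    ∀ᵐ x, (𝓕 (h2.toLp f) : Lp (α := ℝ) ℂ 2 volume) x = 𝓕 f x := by
  have hc : Continuous (𝓕 f) :=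
    VectorFourier.fourierIntegral_continuous Real.continuous_fourierChar continuous_inner hf
  refine ae_eq_of_integral_contDiff_smul_eq
    ((Lp.memLp (𝓕 (h2.toLp f) : Lp (α := ℝ) ℂ 2 volume)).locallyIntegrable (by norm_num))
    hc.locallyIntegrable ?_
  intro φ hφ hφc
  have hφ1 : HasCompactSupport (fun x => (φ x : ℂ)) := hφc.comp_left (g := Complex.ofReal) (by simp)
  have hφ2 : ContDiff ℝ (⊤ : ℕ∞) (fun x => (φ x : ℂ)) := Complex.ofRealCLM.contDiff.comp hφ
  let Φ : 𝓢(ℝ, ℂ) := hφ1.toSchwartzMap hφ2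
  have hΦ : ∀ x, Φ x = φ x := fun x => rfl
  have h := congrArg (fun T => T Φ) (Lp.fourier_toTemperedDistribution_eq (h2.toLp f))
  simp only [TemperedDistribution.fourier_apply, Lp.toTemperedDistribution_apply] at h
  have e : ∫ x, (𝓕 Φ) x • (h2.toLp f : ℝ → ℂ) x = ∫ x, (𝓕 Φ) x • f x :=
    integral_congr_ae (h2.coeFn_toLp.mono fun x hx => by simp only [hx])
  have e2 := VectorFourier.integral_fourierIntegral_smul_eq_flip (L := innerₗ ℝ) (μ := volume)
    (ν := volume) Real.continuous_fourierChar continuous_inner Φ.integrable hf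
  rw [flip_innerₗ] at e2
  have h5 : ∫ x, Φ x • (𝓕 (h2.toLp f) : Lp (α := ℝ) ℂ 2 volume) x = ∫ x, Φ x • 𝓕 f x := by
    rw [← h, e]
    exact e2
  simpa [hΦ] using h5

open FourierTransform in
lemma plancherel_le (f : ℝ → ℂ) (hf : Integrable f) :
    ∫⁻ ξ, ‖ft f ξ‖ₑ ^ 2 ≤ ENNReal.ofReal (2 * Real.pi) * ∫⁻ x, ‖f x‖ₑ ^ 2 := by
  have hpi := Real.pi_pos
  by_cases htop : ∫⁻ x, ‖f x‖ₑ ^ 2 = ⊤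
  · rw [htop, ENNReal.mul_top (by simp [hpi])]; exact le_top
  have key (F : ℝ → ℂ) : eLpNorm F 2 volume ^ 2 = ∫⁻ x, ‖F x‖ₑ ^ 2 := by
    rw [eLpNorm_eq_lintegral_rpow_enorm_toReal (by norm_num) (by norm_num),
      ← ENNReal.rpow_natCast, ← ENNReal.rpow_mul]
    norm_num
  have h2 : MemLp f 2 volume := by
    refine ⟨hf.1, ?_⟩
    rw [lt_top_iff_ne_top]
    intro h
    rw [← key, h] at htop
    simp at htop
  have hF := fourier_L2_ae f hf h2
  have h3 := Lp.norm_fourier_eq (h2.toLp f)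
  rw [Lp.norm_def, Lp.norm_def, ENNReal.toReal_eq_toReal_iff' (Lp.eLpNorm_ne_top _)
    (Lp.eLpNorm_ne_top _), eLpNorm_congr_ae hF, eLpNorm_congr_ae h2.coeFn_toLp] at h3
  have h4 := congrArg (· ^ 2) h3
  simp only [key] at h4
  rw [← h4]
  have hc : Continuous (𝓕 f) :=
    VectorFourier.fourierIntegral_continuous Real.continuous_fourierChar continuous_inner hf
  have hm : Measurable fun x => ‖𝓕 f x‖ₑ ^ 2 := by
    have := hc.measurable
    fun_prop
  have hne : (2 * Real.pi)⁻¹ ≠ 0 := by positivity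
  have h6 := lintegral_map (μ := volume) hm (measurable_const_mul (2 * Real.pi)⁻¹)
  rw [Real.map_volume_mul_left hne, lintegral_smul_measure, inv_inv,
    abs_of_pos (by positivity)] at h6
  simp_rw [ft_eq]
  rw [smul_eq_mul] at h6
  rw [h6]
  apply le_of_eq
  congr 1; ext x
  rw [div_eq_inv_mul]


/-- Fourier transform of a real function. -/
noncomputable def cF (u : ℝ → ℝ) : ℝ → ℂ := ft fun x => (u x : ℂ)

/-- Fourier transform of the derivative. -/
noncomputable def dF (u : ℝ → ℝ) : ℝ → ℂ := fun ξ => Complex.I * ξ * cF u ξ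

/-- The working class of functions. -/
structure XX (u : ℝ → ℝ) : Prop where
  int : Integrable (fun x => (u x : ℂ))
  intF : Integrable (cF u)
  intF' : Integrable (dF u)
  inv : ∀ x, (u x : ℂ) = invFt (cF u) x

lemma XX.zero : XX (fun _ => 0) := by
  have h : cF (fun _ => 0) = fun _ => 0 := by ext ξ; simp [cF, ft]
  have h' : dF (fun _ => 0) = fun _ => 0 := by ext ξ; simp [dF, h]
  refine ⟨by simp, by rw [h]; simp, by rw [h']; simp, ?_⟩
  intro x; rw [h]; simp [invFt]

lemma cF_sub {u v : ℝ → ℝ} (hu : XX u) (hv : XX v) (ξ : ℝ) :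
    cF (fun x => u x - v x) ξ = cF u ξ - cF v ξ := by
  unfold cF
  rw [← ft_sub _ _ hu.int hv.int]
  simp

lemma dF_sub {u v : ℝ → ℝ} (hu : XX u) (hv : XX v) (ξ : ℝ) :
    dF (fun x => u x - v x) ξ = dF u ξ - dF v ξ := by
  unfold dF
  rw [cF_sub hu hv]; ring

lemma XX.sub {u v : ℝ → ℝ} (hu : XX u) (hv : XX v) : XX (fun x => u x - v x) := by
  have h : cF (fun x => u x - v x) = fun ξ => cF u ξ - cF v ξ := funext (cF_sub hu hv)
  have h' : dF (fun x => u x - v x) = fun ξ => dF u ξ - dF v ξ := funext (dF_sub hu hv)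
  refine ⟨?_, ?_, ?_, ?_⟩
  · have := hu.int.sub hv.int
    refine this.congr (Filter.Eventually.of_forall fun x => by simp)
  · rw [h]; exact hu.intF.sub hv.intF
  · rw [h']; exact hu.intF'.sub hv.intF'
  · intro x
    rw [h, invFt_sub _ _ hu.intF hv.intF, ← hu.inv, ← hv.inv]; simp

lemma XX.cont {u : ℝ → ℝ} (hu : XX u) : Continuous u := by
  have h := invFt_continuous _ hu.intF
  have e : u = fun x => (invFt (cF u) x).re := by
    ext x; rw [← hu.inv]; simp
  rw [e]; exact Complex.continuous_re.comp h

lemma XX.cF_meas {u : ℝ → ℝ} (hu : XX u) : Measurable (cF u) :=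
  (ft_continuous _ hu.int).measurable

lemma XX.dF_meas {u : ℝ → ℝ} (hu : XX u) : Measurable (dF u) := by
  have := hu.cF_meas
  unfold dF; fun_prop

lemma XX.hasDeriv {u : ℝ → ℝ} (hu : XX u) (x : ℝ) :
    HasDerivAt u (invFt (dF u) x).re x ∧ (((invFt (dF u) x).re : ℝ) : ℂ) = invFt (dF u) x := by
  have h := invFt_hasDerivAt _ hu.intF hu.intF' x
  have e : invFt (cF u) = fun x => (u x : ℂ) := funext fun x => (hu.inv x).symm
  rw [e] at h
  have h1 : HasDerivAt u (invFt (dF u) x).re x := by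
    have := Complex.reCLM.hasFDerivAt.comp_hasDerivAt x h
    exact this
  exact ⟨h1, h1.ofReal_comp.unique h⟩

lemma enorm_ofReal_c (a : ℝ) : ‖(a : ℂ)‖ₑ = ‖a‖ₑ := by
  rw [← ofReal_norm, ← ofReal_norm]; simp

lemma bdd_of_enorm {U : ℝ → ℂ} (hU : Integrable U) : ∃ M : ℝ, ∀ x, ‖invFt U x‖ ≤ M := by
  refine ⟨(∫⁻ ξ, ‖U ξ‖ₑ).toReal, fun x => ?_⟩
  rw [← toReal_enorm]
  exact ENNReal.toReal_mono hU.2.ne (invFt_enorm_le U x)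

lemma XX.bdd {u : ℝ → ℝ} (hu : XX u) : ∃ M : ℝ, ∀ x, |u x| ≤ M := by
  obtain ⟨M, hM⟩ := bdd_of_enorm hu.intF
  refine ⟨M, fun x => ?_⟩
  have := hM x
  rw [← hu.inv] at this
  simpa using this

lemma XX.sup_le {u : ℝ → ℝ} (hu : XX u) (x : ℝ) :
    ‖u x‖ₑ ^ 2 ≤ (∫⁻ ξ, wJ (-1) ξ) * hN 1 (cF u) := by
  refine le_trans ?_ (hN_L1 (r := 1) _ hu.cF_meas)
  gcongr
  rw [← enorm_ofReal_c, hu.inv]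
  exact invFt_enorm_le _ _

lemma lip_loc {g : ℝ → ℝ} (hg : ContDiff ℝ (⊤ : ℕ∞) g) (M : ℝ) :
    ∃ L : NNReal, ∀ a b : ℝ, |a| ≤ M → |b| ≤ M → ‖g a - g b‖ₑ ≤ L * ‖a - b‖ₑ := by
  have hc : Continuous (deriv g) := hg.continuous_deriv (by simp)
  obtain ⟨L, hL⟩ := (isCompact_Icc (a := -M) (b := M)).exists_bound_of_continuousOn hc.continuousOn
  refine ⟨L.toNNReal, fun a b ha hb => ?_⟩
  have h := (convex_Icc (-M) M).norm_image_sub_le_of_norm_deriv_le (f := g) (C := L)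
    (fun x _ => (hg.differentiable (by simp)) x) hL
    (abs_le.mp hb) (abs_le.mp ha)
  rw [← ofReal_norm, ← ofReal_norm]
  calc _ ≤ ENNReal.ofReal (L * ‖a - b‖) := ENNReal.ofReal_le_ofReal h
    _ = _ := by rw [ENNReal.ofReal_mul' (by positivity)]; rfl

lemma int_comp {g : ℝ → ℝ} (hg : ContDiff ℝ (⊤ : ℕ∞) g) {u v : ℝ → ℝ} (hu : XX u) (hv : XX v) :
    Integrable (fun x => ((g (u x) - g (v x) : ℝ) : ℂ)) := by
  obtain ⟨M₁, h1⟩ := hu.bdd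
  obtain ⟨M₂, h2⟩ := hv.bdd
  obtain ⟨L, hL⟩ := lip_loc hg (max M₁ M₂)
  have hgc := hg.continuous
  have huc := hu.cont
  have hvc := hv.cont
  refine ((hu.sub hv).int.const_mul (L : ℂ)).mono (by fun_prop) ?_
  refine Filter.Eventually.of_forall fun x => ?_
  have h := hL (u x) (v x) ((h1 x).trans (le_max_left _ _)) ((h2 x).trans (le_max_right _ _))
  rw [← ofReal_norm, ← ofReal_norm, ← ENNReal.ofReal_coe_nnreal, ← ENNReal.ofReal_mul (by simp),
    ENNReal.ofReal_le_ofReal_iff (by positivity)] at h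
  rw [norm_mul, Complex.norm_real, Complex.norm_real, Complex.norm_real]
  simpa only [NNReal.norm_eq] using h

lemma contDiff_deriv' {g : ℝ → ℝ} (hg : ContDiff ℝ (⊤ : ℕ∞) g) :
    ContDiff ℝ (⊤ : ℕ∞) (deriv g) := by
  have := (contDiff_infty_iff_deriv (𝕜 := ℝ) (f := g)).1 hg
  exact this.2

lemma int_mul_invFt {h U : ℝ → ℂ} (hh : Integrable h) (hU : Integrable U) :
    Integrable (fun x => h x * invFt U x) := by
  obtain ⟨M, hM⟩ := bdd_of_enorm hU
  have hc := invFt_continuous U hU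
  exact hh.mul_bdd (c := M) hc.aestronglyMeasurable (Filter.Eventually.of_forall hM)

lemma deriv_split {g : ℝ → ℝ} (hg : ContDiff ℝ (⊤ : ℕ∞) g) (hg0 : deriv g 0 = 0)
    {u v : ℝ → ℝ} (hu : XX u) (hv : XX v) :
    Integrable (fun x => ((deriv g (u x) - deriv g (v x) : ℝ) : ℂ) * invFt (dF u) x) ∧
    Integrable (fun x => ((deriv g (v x) - deriv g 0 : ℝ) : ℂ)
      * invFt (dF fun x => u x - v x) x) ∧
    (∀ ξ, dF (fun x => g (u x) - g (v x)) ξ =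
      ft (fun x => ((deriv g (u x) - deriv g (v x) : ℝ) : ℂ) * invFt (dF u) x) ξ +
      ft (fun x => ((deriv g (v x) - deriv g 0 : ℝ) : ℂ) * invFt (dF fun x => u x - v x) x) ξ) := by
  have hg' := contDiff_deriv' hg
  have i1 := int_mul_invFt (int_comp hg' hu hv) hu.intF'
  have i2 := int_mul_invFt (int_comp hg' hv XX.zero) (hu.sub hv).intF'
  refine ⟨i1, i2, fun ξ => ?_⟩
  rw [← ft_add _ _ i1 i2]
  symm
  refine ft_deriv _ _ (int_comp hg hu hv) (i1.add i2) (fun x => ?_) ξ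
  have hgd : ∀ y, HasDerivAt g (deriv g y) y := fun y => (hg.differentiable (by simp) y).hasDerivAt
  have a := ((hgd (u x)).comp x (hu.hasDeriv x).1).sub ((hgd (v x)).comp x (hv.hasDeriv x).1)
  refine a.ofReal_comp.congr_deriv ?_
  have e : invFt (dF fun x => u x - v x) x = invFt (dF u) x - invFt (dF v) x := by
    rw [← invFt_sub _ _ hu.intF' hv.intF']
    congr 1; ext ξ; exact dF_sub hu hv ξ
  simp only [Pi.add_apply]
  rw [e, hg0]
  push_cast
  rw [(hu.hasDeriv x).2, (hv.hasDeriv x).2]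
  ring

/-- Local Lipschitz property in `H^s`. -/
def LipAt (s : ℝ) : Prop := ∀ g : ℝ → ℝ, ContDiff ℝ (⊤ : ℕ∞) g → ∀ R : ENNReal, R ≠ ⊤ →
  ∃ C : ENNReal, C ≠ ⊤ ∧ ∀ u v : ℝ → ℝ, XX u → XX v → hN s (cF u) ≤ R → hN s (cF v) ≤ R →
    hN s (cF fun x => g (u x) - g (v x)) ≤ C * hN s (cF fun x => u x - v x)

/-- The same for functions with vanishing derivative at the origin. -/
def LipAt0 (s : ℝ) : Prop := ∀ g : ℝ → ℝ, ContDiff ℝ (⊤ : ℕ∞) g → deriv g 0 = 0 →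
  ∀ R : ENNReal, R ≠ ⊤ →
  ∃ C : ENNReal, C ≠ ⊤ ∧ ∀ u v : ℝ → ℝ, XX u → XX v → hN s (cF u) ≤ R → hN s (cF v) ≤ R →
    hN s (cF fun x => g (u x) - g (v x)) ≤ C * hN s (cF fun x => u x - v x)

lemma LipAt_of_zero {s : ℝ} (h : LipAt0 s) : LipAt s := by
  intro g hg R hR
  set a := deriv g 0 with ha
  have hg1 : ContDiff ℝ (⊤ : ℕ∞) (fun y => g y - a * y) := by fun_prop
  have hd : deriv (fun y => g y - a * y) 0 = 0 := by
    have h1 := (hg.differentiable (by simp) 0).hasDerivAt.sub ((hasDerivAt_id (0 : ℝ)).const_mul a)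
    have h2 := h1.deriv
    rw [← ha, mul_one, sub_self] at h2
    exact h2
  obtain ⟨C, hC, H⟩ := h _ hg1 hd R hR
  refine ⟨2 * C + 2 * ‖(a : ℂ)‖ₑ ^ 2, by finiteness, fun u v hu hv hu' hv' => ?_⟩
  have H1 := H u v hu hv hu' hv'
  have i1 := int_comp hg1 hu hv
  have i2 := (hu.sub hv).int
  have e : cF (fun x => g (u x) - g (v x)) = fun ξ =>
      cF (fun x => (g (u x) - a * u x) - (g (v x) - a * v x)) ξ
        + (a : ℂ) * cF (fun x => u x - v x) ξ := by
    ext ξ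
    unfold cF
    rw [← ft_const_mul, ← ft_add _ _ i1 (i2.const_mul _)]
    congr 1; ext x
    push_cast; ring
  rw [e]
  refine (hN_add s _ _ (ft_continuous _ i1).measurable).trans ?_
  rw [hN_const_mul]
  calc _ ≤ 2 * (C * hN s (cF fun x => u x - v x))
        + 2 * (‖(a : ℂ)‖ₑ ^ 2 * hN s (cF fun x => u x - v x)) := by gcongr; exact H1
    _ = _ := by ring

lemma hN_split {g : ℝ → ℝ} (hg : ContDiff ℝ (⊤ : ℕ∞) g) (hg0 : deriv g 0 = 0)
    {u v : ℝ → ℝ} (hu : XX u) (hv : XX v) (t : ℝ) :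
    hN (t + 1) (cF fun x => g (u x) - g (v x)) ≤ hN t (cF fun x => g (u x) - g (v x)) +
      (2 * hN t (ft (fun x => ((deriv g (u x) - deriv g (v x) : ℝ) : ℂ) * invFt (dF u) x)) +
      2 * hN t (ft (fun x => ((deriv g (v x) - deriv g 0 : ℝ) : ℂ)
        * invFt (dF fun x => u x - v x) x))) := by
  obtain ⟨i1, i2, h⟩ := deriv_split hg hg0 hu hv
  have e : hN t (fun ξ => Complex.I * ξ * cF (fun x => g (u x) - g (v x)) ξ) =
    hN t (fun ξ => ft (fun x => ((deriv g (u x) - deriv g (v x) : ℝ) : ℂ) * invFt (dF u) x) ξ +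
      ft (fun x => ((deriv g (v x) - deriv g 0 : ℝ) : ℂ) *
        invFt (dF fun x => u x - v x) x) ξ) := by
    congr 1; ext ξ; exact h ξ
  have hm : Measurable (cF fun x => g (u x) - g (v x)) :=
    (ft_continuous _ (int_comp hg hu hv)).measurable
  rw [hN_succ _ _ hm, e]
  gcongr
  exact hN_add t _ _ (ft_continuous _ i1).measurable

lemma hN_dF_le (t : ℝ) {u : ℝ → ℝ} (hu : XX u) : hN t (dF u) ≤ hN (t + 1) (cF u) := by
  rw [hN_succ _ _ hu.cF_meas]
  exact le_add_self

lemma LipAt_step {t : ℝ} (ht : 0 ≤ t) (h : LipAt (max 1 t)) : LipAt (t + 1) := by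
  apply LipAt_of_zero
  intro g hg hg0 R hR
  have hg' := contDiff_deriv' hg
  obtain ⟨C1, hC1, H1⟩ := h g hg R hR
  obtain ⟨C2, hC2, H2⟩ := h _ hg' R hR
  obtain ⟨K, hK, HK⟩ := hN_conv ht (le_max_right 1 t)
    (lt_of_lt_of_le (by norm_num) (le_max_left 1 t))
  have hrs : max 1 t ≤ t + 1 := max_le (by linarith) (by linarith)
  refine ⟨C1 + 4 * (K * C2 * R), by finiteness, fun u v hu hv hu' hv' => ?_⟩
  have hur := (hN_mono hrs _).trans hu'
  have hvr := (hN_mono hrs _).trans hv'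
  have hw := hu.sub hv
  have prod (f : ℝ → ℂ) (w : ℝ → ℝ) (hf : Integrable f) (hw : XX w) :
      hN t (ft fun x => f x * invFt (dF w) x) ≤ K * hN (max 1 t) (ft f) * hN (t + 1) (cF w) := by
    have e : ft (fun x => f x * invFt (dF w) x) = fun ξ =>
      ((2 * Real.pi : ℝ)⁻¹ : ℂ) * ∫ η, ft f (ξ - η) * dF w η :=
      funext fun ξ => ft_mul_invFt _ _ hf hw.intF' ξ
    rw [e, hN_const_mul]
    have c1 : ‖((2 * Real.pi : ℝ)⁻¹ : ℂ)‖ₑ ≤ 1 := by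
      rw [← Complex.ofReal_inv, enorm_ofReal_c]; exact two_pi_inv_enorm_le
    calc _ ≤ 1 ^ 2 * (K * hN (max 1 t) (ft f) * hN t (dF w)) := by
          gcongr
          exact HK _ _ (ft_continuous _ hf).measurable hw.dF_meas
      _ ≤ _ := by
          rw [one_pow, one_mul]; gcongr; exact hN_dF_le t hw
  have z0 : hN (max 1 t) (cF fun _ => 0) ≤ R := by simp [hN, cF, ft]
  have B1 := prod _ u (int_comp hg' hu hv) hu
  have B2 := prod _ _ (int_comp hg' hv XX.zero) hw
  have A1 := H2 u v hu hv hur hvr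
  have A2 := H2 v _ hv XX.zero hvr z0
  simp only [sub_zero] at A2
  set W := hN (t + 1) (cF fun x => u x - v x)
  have hWr : hN (max 1 t) (cF fun x => u x - v x) ≤ W := hN_mono hrs _
  calc _ ≤ _ := hN_split hg hg0 hu hv t
    _ ≤ C1 * W + (2 * (K * (C2 * W) * R) + 2 * (K * (C2 * R) * W)) := by
        gcongr
        · exact (hN_mono (le_max_right 1 t) _).trans ((H1 u v hu hv hur hvr).trans (by gcongr))
        · refine B1.trans ?_
          gcongr
          exact A1.trans (by gcongr)
        · refine B2.trans ?_
          gcongr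
          exact A2.trans (by gcongr)
    _ = _ := by ring

lemma plancherel_inv_le (W : ℝ → ℂ) (hW : Integrable W) :
    ∫⁻ x, ‖invFt W x‖ₑ ^ 2 ≤ ENNReal.ofReal (2 * Real.pi) * hN 0 W := by
  have h := plancherel_le W hW
  simp only [hN, wJ_zero, one_mul]
  refine le_trans ?_ h
  calc _ ≤ ∫⁻ x, ‖ft W (-x)‖ₑ ^ 2 := by
        refine lintegral_mono fun x => ?_
        rw [invFt_eq, enorm_smul]
        gcongr
        exact mul_le_of_le_one_left' two_pi_inv_enorm_le
    _ = _ := lintegral_neg_eq_self (fun x => ‖ft W x‖ₑ ^ 2)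

lemma hN_zero_prod (f U : ℝ → ℂ) (B : ENNReal)
    (hfU : Integrable fun x => f x * invFt U x) (hf : ∀ x, ‖f x‖ₑ ^ 2 ≤ B) (hU : Integrable U) :
    hN 0 (ft fun x => f x * invFt U x) ≤ ENNReal.ofReal (2 * Real.pi) ^ 2 * (B * hN 0 U) := by
  have h := plancherel_le _ hfU
  have e (F : ℝ → ℂ) : hN 0 F = ∫⁻ x, ‖F x‖ₑ ^ 2 := by simp only [hN, wJ_zero, one_mul]
  rw [e]
  refine h.trans ?_
  calc _ ≤ ENNReal.ofReal (2 * Real.pi) * ∫⁻ x, B * ‖invFt U x‖ₑ ^ 2 := by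
        gcongr with x
        rw [enorm_mul, mul_pow]
        gcongr
        exact hf x
    _ ≤ ENNReal.ofReal (2 * Real.pi) * (B * (ENNReal.ofReal (2 * Real.pi) * hN 0 U)) := by
        have hm : Measurable fun x => ‖invFt U x‖ₑ ^ 2 := by
          have := (invFt_continuous U hU).measurable
          exact this.enorm.pow_const 2
        rw [lintegral_const_mul _ hm]
        gcongr
        exact plancherel_inv_le U hU
    _ = _ := by ring

lemma LipAt_one : LipAt 1 := by
  apply LipAt_of_zero
  intro g hg hg0 R hR
  have hg' := contDiff_deriv' hg
  set A := ∫⁻ ξ, wJ (-1) ξ with hA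
  have hAt : A ≠ ⊤ := wJ_integrable (by norm_num)
  set M := Real.sqrt (A * R).toReal
  obtain ⟨L1, hL1⟩ := lip_loc hg M
  obtain ⟨L2, hL2⟩ := lip_loc hg' M
  set P := ENNReal.ofReal (2 * Real.pi)
  have hP : P ≠ ⊤ := ENNReal.ofReal_ne_top
  refine ⟨P ^ 2 * L1 ^ 2 + 4 * (P ^ 2 * (L2 ^ 2 * A * R)), by finiteness,
    fun u v hu hv hu' hv' => ?_⟩
  have hw := hu.sub hv
  have bd {u : ℝ → ℝ} (hu : XX u) (hu' : hN 1 (cF u) ≤ R) (x : ℝ) : |u x| ≤ M := by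
    have h1 : ‖u x‖ₑ ^ 2 ≤ A * R := (hu.sup_le x).trans (by gcongr)
    have h2 := ENNReal.toReal_mono (by finiteness) h1
    rw [ENNReal.toReal_pow, toReal_enorm, Real.norm_eq_abs] at h2
    exact Real.le_sqrt_of_sq_le h2
  have hMn : 0 ≤ M := Real.sqrt_nonneg _
  set W := hN 1 (cF fun x => u x - v x) with hWdef
  have hs := hN_split hg hg0 hu hv 0
  rw [zero_add] at hs
  obtain ⟨i1, i2, -⟩ := deriv_split hg hg0 hu hv
  have T1 : hN 0 (cF fun x => g (u x) - g (v x)) ≤ P ^ 2 * L1 ^ 2 * W := by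
    have h := plancherel_le _ (int_comp hg hu hv)
    have e (F : ℝ → ℂ) : hN 0 F = ∫⁻ x, ‖F x‖ₑ ^ 2 := by simp only [hN, wJ_zero, one_mul]
    rw [e]
    refine h.trans ?_
    calc _ ≤ P * ∫⁻ x, (L1 : ENNReal) ^ 2 * ‖invFt (cF fun x => u x - v x) x‖ₑ ^ 2 := by
          gcongr with x
          rw [← mul_pow, ← hw.inv, enorm_ofReal_c, enorm_ofReal_c]
          gcongr
          exact hL1 _ _ (bd hu hu' x) (bd hv hv' x)
      _ ≤ P * (L1 ^ 2 * (P * W)) := by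
          rw [lintegral_const_mul' _ _ (by finiteness)]
          gcongr
          exact (plancherel_inv_le _ hw.intF).trans (by gcongr; exact hN_mono zero_le_one _)
      _ = _ := by ring
  have T2 := hN_zero_prod _ _ (L2 ^ 2 * (A * W)) i1 (fun x => by
    rw [enorm_ofReal_c]
    calc _ ≤ (L2 * ‖u x - v x‖ₑ) ^ 2 := by
          gcongr; exact hL2 _ _ (bd hu hu' x) (bd hv hv' x)
      _ = L2 ^ 2 * ‖u x - v x‖ₑ ^ 2 := by ring
      _ ≤ _ := by gcongr; exact hw.sup_le x) hu.intF'
  have T3 := hN_zero_prod _ _ (L2 ^ 2 * (A * R)) i2 (fun x => by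
    rw [enorm_ofReal_c]
    calc _ ≤ (L2 * ‖v x - 0‖ₑ) ^ 2 := by
          gcongr; exact hL2 _ _ (bd hv hv' x) (by simpa using hMn)
      _ = L2 ^ 2 * ‖v x‖ₑ ^ 2 := by rw [sub_zero]; ring
      _ ≤ _ := by gcongr; exact (hv.sup_le x).trans (by gcongr)) hw.intF'
  have d1 := hN_dF_le 0 hu
  have d2 := hN_dF_le 0 hw
  rw [zero_add] at d1 d2
  calc _ ≤ _ := hs
    _ ≤ P ^ 2 * L1 ^ 2 * W + (2 * (P ^ 2 * (L2 ^ 2 * (A * W) * R))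
        + 2 * (P ^ 2 * (L2 ^ 2 * (A * R) * W))) := by
        gcongr
        · exact T2.trans (by gcongr; exact d1.trans hu')
        · exact T3.trans (by gcongr)
    _ = _ := by ring

lemma LipAt_all (n : ℕ) : ∀ s : ℝ, 1 ≤ s → s ≤ n + 1 → LipAt s := by
  induction n with
  | zero =>
    intro s h1 h2
    have : s = 1 := by simp at h2; linarith
    rw [this]; exact LipAt_one
  | succ n ih =>
    intro s h1 h2
    push_cast at h2
    have := LipAt_step (t := s - 1) (by linarith)
      (ih _ (le_max_left _ _) (max_le (by linarith [n.cast_nonneg (α := ℝ)]) (by linarith)))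
    rwa [sub_add_cancel] at this

lemma integrand_eq (s : ℝ) (U : ℝ → ℂ) (ξ : ℝ) :
    ENNReal.ofReal ((1 + ξ ^ 2) ^ s * ‖U ξ‖ ^ 2) = wJ s ξ * ‖U ξ‖ₑ ^ 2 := by
  have := wJ_base ξ
  unfold wJ
  rw [ENNReal.ofReal_mul (by positivity), ENNReal.ofReal_pow (by positivity), ofReal_norm]

lemma hsNorm_eq (s : ℝ) (U : ℝ → ℂ) (hU : Measurable U) :
    hsNorm s U = (hN s U).toReal ^ ((1 : ℝ) / 2) := by
  unfold hsNorm hN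
  rw [integral_eq_lintegral_of_nonneg_ae]
  · simp_rw [integrand_eq]
  · refine Filter.Eventually.of_forall fun ξ => ?_
    have := wJ_base ξ
    simp only [Pi.zero_apply]
    positivity
  · refine Measurable.aestronglyMeasurable ?_
    fun_prop

lemma hN_ne_top {s : ℝ} {u : ℝ → ℝ} (h : MemHs s (fun x => (u x : ℂ))) : hN s (cF u) ≠ ⊤ := by
  have := h.2.1.lintegral_lt_top
  simp_rw [integrand_eq] at this
  exact this.ne

lemma integrable_of_hN {r : ℝ} (hr : 1 / 2 < r) {U : ℝ → ℂ} (hU : Measurable U)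
    (h : hN r U ≠ ⊤) : Integrable U := by
  refine ⟨hU.aestronglyMeasurable, ?_⟩
  have h1 := hN_L1 (r := r) U hU
  have h2 := wJ_integrable hr
  have h3 : (∫⁻ ξ, wJ (-r) ξ) * hN r U < ⊤ := by finiteness
  have h4 := lt_of_le_of_lt h1 h3
  rw [hasFiniteIntegral_iff_enorm]
  by_contra hc
  rw [not_lt, top_le_iff] at hc
  simp [hc] at h4

lemma XX_of_mem {s : ℝ} (hs : 3 / 2 < s) {u : ℝ → ℝ} (h : MemHs s (fun x => (u x : ℂ))) :
    XX u := by
  have hm : Measurable (cF u) := (ft_continuous _ h.1).measurable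
  have hm' : Measurable (dF u) := by unfold dF; fun_prop
  have ht := hN_ne_top h
  refine ⟨h.1, integrable_of_hN (r := s) (by linarith) hm ht,
    integrable_of_hN (r := s - 1) (by linarith) hm' ?_, h.2.2⟩
  have e := hN_succ (s - 1) _ hm
  rw [sub_add_cancel] at e
  rw [e] at ht
  exact (ENNReal.add_ne_top.1 ht).2


/-- let `g ∈ C^∞(ℝ)` with `g(0) = 0` and `s > 3/2`.  For every `R > 0`
there is `C₂ = C₂(g,R)` such that for all `u, v ∈ H^s(ℝ)` with `‖u‖_{H^s} ≤ R` and
`‖v‖_{H^s} ≤ R`, one has `‖g∘u − g∘v‖_{H^s} ≤ C₂ ‖u − v‖_{H^s}`. -/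
theorem composition_locally_lipschitz_Hs
    (g : ℝ → ℝ) (hg : ContDiff ℝ (⊤ : ℕ∞) g) (hg0 : g 0 = 0)
    (s : ℝ) (hs : 3 / 2 < s) :
    ∀ R : ℝ, 0 < R → ∃ C₂ : ℝ, ∀ u v : ℝ → ℝ,
      MemHs s (fun x => (u x : ℂ)) → MemHs s (fun x => (v x : ℂ)) →
      hsNorm s (ft fun x => (u x : ℂ)) ≤ R →
      hsNorm s (ft fun x => (v x : ℂ)) ≤ R →
      hsNorm s (ft fun x => ((g (u x) - g (v x) : ℝ) : ℂ)) ≤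
        C₂ * hsNorm s (ft fun x => ((u x - v x : ℝ) : ℂ)) := by
  intro R hR
  obtain ⟨n, hn⟩ := exists_nat_ge s
  obtain ⟨C, hC, H⟩ := LipAt_all n s (by linarith) (by linarith) g hg (ENNReal.ofReal (R ^ 2))
    (by simp)
  refine ⟨C.toReal ^ ((1 : ℝ) / 2), fun u v hu hv huR hvR => ?_⟩
  have xu := XX_of_mem hs hu
  have xv := XX_of_mem hs hv
  have conv {u : ℝ → ℝ} (hu : MemHs s (fun x => (u x : ℂ))) (xu : XX u)
      (huR : hsNorm s (ft fun x => (u x : ℂ)) ≤ R) : hN s (cF u) ≤ ENNReal.ofReal (R ^ 2) := by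
    rw [hsNorm_eq s (ft fun x => (u x : ℂ)) xu.cF_meas, ← Real.sqrt_eq_rpow, Real.sqrt_le_left hR.le] at huR
    exact (ENNReal.le_ofReal_iff_toReal_le (hN_ne_top hu) (by positivity)).2 huR
  have h := H u v xu xv (conv hu xu huR) (conv hv xv hvR)
  have m1 : Measurable (ft fun x => ((g (u x) - g (v x) : ℝ) : ℂ)) :=
    (ft_continuous _ (int_comp hg xu xv)).measurable
  have m2 := (xu.sub xv).cF_meas
  have ew : cF (fun x => u x - v x) = fun ξ => cF u ξ + (-1 : ℂ) * cF v ξ := by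
    ext ξ; rw [cF_sub xu xv]; ring
  have hw : hN s (cF fun x => u x - v x) ≠ ⊤ := by
    have a := hN_ne_top hu
    have b := hN_ne_top hv
    rw [ew]
    refine ne_top_of_le_ne_top ?_ (hN_add s _ _ xu.cF_meas)
    rw [hN_const_mul]
    finiteness
  rw [hsNorm_eq _ _ m1, hsNorm_eq s (ft fun x => ((u x - v x : ℝ) : ℂ)) m2,
    ← Real.mul_rpow (by positivity) (by positivity)]
  refine Real.rpow_le_rpow (by positivity) ?_ (by norm_num)
  rw [← ENNReal.toReal_mul]
  exact ENNReal.toReal_mono (by finiteness) h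
end
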